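/- For a metric space X, functions f, g : X → [−∞,∞] with nonempty epigraphs, and ρ ≥ 0: dl_ρ(epi f, epi g) ≤ sup_{x ∈ A_ρ} |f(x) − g(x)|, where A_ρ = (lev_ρ f ∪ lev_ρ g) ∩ B_X(ρ) (with the supremum over an empty set interpreted as 0). -/

import Mathlib

open Set Filter Metric ENNReal Pointwise Classical

noncomputable section

/-- Excess of `A` over `B`: `sup_{x ∈ A} dist(x,B)`, valued in `ℝ≥0∞`
(so it is `0` when `A = ∅` and `∞` when `A ≠ ∅`, `B = ∅`). -/
def exs {X : Type*} [PseudoEMetricSpace X] (A B : Set X) : ℝ≥0∞ :=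
  ⨆ x ∈ A, EMetric.infEdist x B

/-- Truncated Hausdorff distance with centroid `c` and radius `ρ`. -/
def dl {X : Type*} [PseudoEMetricSpace X] (c : X) (ρ : ℝ≥0∞) (A B : Set X) : ℝ≥0∞ :=
  max (exs (A ∩ EMetric.closedBall c ρ) B) (exs (B ∩ EMetric.closedBall c ρ) A)

/-- Epigraph of an extended-real-valued function. -/
def epi {X : Type*} (f : X → EReal) : Set (X × ℝ) :=
  {p | f p.1 ≤ (p.2 : EReal)}

/-- Absolute difference of extended reals, valued in `ℝ≥0∞`. -/
def eAbsDiff (a b : EReal) : ℝ≥0∞ :=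
  sInf {ε : ℝ≥0∞ | a ≤ b + (ε : EReal) ∧ b ≤ a + (ε : EReal)}

theorem key_excess {X : Type*} [MetricSpace X] (f g : X → EReal) (p : X × ℝ) (hp : p ∈ epi f) :
    EMetric.infEdist p (epi g) ≤ sInf {ε : ℝ≥0∞ | g p.1 ≤ f p.1 + (ε : EReal)} := by
  refine le_sInf ?_
  intro ε hε
  rcases eq_or_ne ε ⊤ with rfl | hne
  · exact le_top
  lift ε to NNReal using hne
  have hmem : ((p.1, p.2 + (ε : ℝ)) : X × ℝ) ∈ epi g := by
    have h1 : g p.1 ≤ f p.1 + ((ε : ℝ≥0∞) : EReal) := hε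
    have h2 : f p.1 ≤ (p.2 : EReal) := hp
    have h3 : g p.1 ≤ (p.2 : EReal) + ((ε : ℝ≥0∞) : EReal) := h1.trans (by gcongr)
    show g p.1 ≤ ((p.2 + (ε : ℝ) : ℝ) : EReal)
    rw [EReal.coe_add]
    exact h3
  refine (Metric.infEDist_le_edist_of_mem hmem).trans ?_
  rw [Prod.edist_eq]
  simp [edist_dist, Real.dist_eq]

theorem ball_mem {X : Type*} [MetricSpace X] (c : X) (ρ : ℝ) (hρ : 0 ≤ ρ) (p : X × ℝ)
    (hp : p ∈ EMetric.closedBall (c, (0 : ℝ)) (ENNReal.ofReal ρ)) :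
    p.1 ∈ Metric.closedBall c ρ ∧ p.2 ≤ ρ := by
  have h : edist p (c, (0 : ℝ)) ≤ ENNReal.ofReal ρ := hp
  rw [edist_le_ofReal hρ, Prod.dist_eq, max_le_iff] at h
  refine ⟨h.1, ?_⟩
  have := h.2
  rw [Real.dist_eq, sub_zero] at this
  exact (le_abs_self _).trans this

/-- estimate from the sup-norm. -/
theorem stmt12 {X : Type*} [MetricSpace X] (c : X) (f g : X → EReal)
    (hf : (epi f).Nonempty) (hg : (epi g).Nonempty) (ρ : ℝ) (hρ : 0 ≤ ρ) :
    dl (c, (0 : ℝ)) (ENNReal.ofReal ρ) (epi f) (epi g)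
      ≤ ⨆ x ∈ ({x | f x ≤ ((ρ : ℝ) : EReal)} ∪ {x | g x ≤ ((ρ : ℝ) : EReal)})
            ∩ Metric.closedBall c ρ,
          eAbsDiff (f x) (g x) := by
  refine max_le ?_ ?_
  · refine iSup₂_le fun p hp => ?_
    obtain ⟨h1, h2⟩ := ball_mem c ρ hρ p hp.2
    have h3 : f p.1 ≤ (p.2 : EReal) := hp.1
    refine ((key_excess f g p hp.1).trans (sInf_le_sInf fun ε hε => hε.2)).trans
      (le_iSup₂ (f := fun x _ => eAbsDiff (f x) (g x)) p.1
        ⟨Or.inl (h3.trans (EReal.coe_le_coe_iff.2 h2)), h1⟩)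
  · refine iSup₂_le fun p hp => ?_
    obtain ⟨h1, h2⟩ := ball_mem c ρ hρ p hp.2
    have h3 : g p.1 ≤ (p.2 : EReal) := hp.1
    refine ((key_excess g f p hp.1).trans (sInf_le_sInf fun ε hε => hε.1)).trans
      (le_iSup₂ (f := fun x _ => eAbsDiff (f x) (g x)) p.1
        ⟨Or.inr (h3.trans (EReal.coe_le_coe_iff.2 h2)), h1⟩)
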